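/- Let l ≥ 1, let σ_1, …, σ_l > 0, and let ν be the product Gaussian law on ℝˡ whose j-th coordinate has law N(m_j, σ_j²) (independent components). For every rate R ≥ 0 and every ε > 0 there exist a blocklength n ≥ 1 and a code (f, g) with at most 2^(n(R+ε)) codewords whose expected per-vector squared-error distortion on n i.i.d. samples from ν is at most min { Σ_{j=1}^l σ_j² · 2^(−2ρ_j) : ρ ∈ ℝˡ, ρ_j ≥ 0 for all j, Σ_{j=1}^l ρ_j ≤ R } + ε. (Achievability part of Theorem 2 of the paper for a Gaussian memoryless vector source with independent components.) -/

import Mathlib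

open MeasureTheory ProbabilityTheory

/-- Expected per-vector squared-error distortion of a blocklength-`n` code `(f, g)` with
`M` codewords on an `ℝˡ`-valued source with i.i.d. vector samples of law `ν`. -/
noncomputable def vecExpectedDistortion (l n M : ℕ) (ν : Measure (Fin l → ℝ))
    (f : (Fin n → Fin l → ℝ) → Fin M) (g : Fin M → Fin n → Fin l → ℝ) : ℝ :=
  ∫ x, (1 / (n : ℝ)) * ∑ i, ∑ j, (x i j - g (f x) i j) ^ 2
    ∂(Measure.pi fun _ : Fin n => ν)

/-- Optimal value of the bit-allocation problem with variances `σⱼ²` and rate budget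
`R`: the minimum of `∑ⱼ σⱼ² 2^(-2ρⱼ)` over `ρ ≥ 0` with `∑ⱼ ρⱼ ≤ R`. -/
noncomputable def bitAllocationValue (l : ℕ) (σ : Fin l → ℝ) (R : ℝ) : ℝ :=
  sInf {d : ℝ | ∃ ρ : Fin l → ℝ, (∀ j, 0 ≤ ρ j) ∧ (∑ j, ρ j) ≤ R ∧
    d = ∑ j, (σ j) ^ 2 * 2 ^ (-(2 * ρ j))}

open scoped ENNReal

lemma lintegral_pi_prod' {ι : Type*} [Fintype ι] {α : ι → Type*} [∀ i, MeasurableSpace (α i)]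
    (μ : ∀ i, Measure (α i)) [∀ i, IsProbabilityMeasure (μ i)] (f : ∀ i, α i → ℝ≥0∞)
    (hf : ∀ i, Measurable (f i)) :
    ∫⁻ x, ∏ i, f i (x i) ∂(Measure.pi μ) = ∏ i, ∫⁻ a, f i a ∂(μ i) := by
  have h := lintegral_prod_eq_prod_lintegral_of_indepFun (μ := Measure.pi μ) Finset.univ
    (fun i x => f i (x i)) (iIndepFun_pi (μ := μ) (X := f) fun i => (hf i).aemeasurable)
    (fun i => (hf i).comp (measurable_pi_apply i))
  rw [h]
  refine Finset.prod_congr rfl fun i _ => ?_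
  exact (measurePreserving_eval μ i).lintegral_comp (hf i)

lemma pi_withDensity' {ι : Type*} [Fintype ι] {α : ι → Type*} [∀ i, MeasurableSpace (α i)]
    (μ : ∀ i, Measure (α i)) [∀ i, IsProbabilityMeasure (μ i)] (f : ∀ i, α i → ℝ≥0∞)
    (hf : ∀ i, Measurable (f i)) [∀ i, IsProbabilityMeasure ((μ i).withDensity (f i))] :
    Measure.pi (fun i => (μ i).withDensity (f i)) =
      (Measure.pi μ).withDensity (fun x => ∏ i, f i (x i)) := by
  refine Measure.pi_eq fun s hs => ?_
  rw [withDensity_apply _ (MeasurableSet.univ_pi hs), ← lintegral_indicator (MeasurableSet.univ_pi hs)]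
  have : ∀ x : (∀ i, α i), (Set.univ.pi s).indicator (fun x => ∏ i, f i (x i)) x
      = ∏ i, (s i).indicator (f i) (x i) := by
    intro x
    by_cases hx : x ∈ Set.univ.pi s
    · rw [Set.indicator_of_mem hx]
      exact Finset.prod_congr rfl fun i _ => (Set.indicator_of_mem (hx i trivial) _).symm
    · rw [Set.indicator_of_notMem hx]
      simp only [Set.mem_pi, not_forall] at hx
      obtain ⟨i, _, hi⟩ := hx
      exact (Finset.prod_eq_zero (Finset.mem_univ i) (Set.indicator_of_notMem hi _)).symm
  simp_rw [this]
  rw [lintegral_pi_prod' μ _ (fun i => (hf i).indicator (hs i))]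
  refine Finset.prod_congr rfl fun i _ => ?_
  rw [lintegral_indicator (hs i), withDensity_apply _ (hs i)]

lemma joint_pi {ι α β : Type*} [Fintype ι] [MeasurableSpace α] [MeasurableSpace β]
    (ν : ι → Measure α) (κ : ι → Measure β) [∀ i, IsProbabilityMeasure (ν i)]
    [∀ i, IsProbabilityMeasure (κ i)] (r : ι → α × β → ℝ≥0∞) (hr : ∀ i, Measurable (r i))
    [∀ i, IsProbabilityMeasure (((ν i).prod (κ i)).withDensity (r i))] :
    MeasurePreserving (fun w : ι → α × β => ((fun i => (w i).1), (fun i => (w i).2)))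
      (Measure.pi fun i => ((ν i).prod (κ i)).withDensity (r i))
      (((Measure.pi ν).prod (Measure.pi κ)).withDensity
        (fun p => ∏ i, r i (p.1 i, p.2 i))) := by
  have h0 := measurePreserving_arrowProdEquivProdArrow α β ι ν κ
  have hm : Measurable (fun w : ι → α × β => ((fun i => (w i).1), (fun i => (w i).2))) := by
    fun_prop
  refine ⟨hm, ?_⟩
  rw [pi_withDensity' (fun i => (ν i).prod (κ i)) r hr]
  ext s hs
  rw [Measure.map_apply hm hs, withDensity_apply _ (hm hs), withDensity_apply _ hs]
  refine Eq.trans ?_ (h0.setLIntegral_comp_preimage hs ?_)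
  · rfl
  · exact Finset.measurable_prod _ fun i _ => (hr i).comp (by fun_prop)

lemma lln {Ω : Type*} [MeasurableSpace Ω] (Q : Measure Ω) [IsProbabilityMeasure Q]
    (F : Ω → ℝ) (hF : MemLp F 2 Q) (δ η : ℝ) (hδ : 0 < δ) (hη : 0 < η) :
    ∀ᶠ n : ℕ in Filter.atTop, (Measure.pi fun _ : Fin n => Q)
      {w | δ * n ≤ |(∑ i, F (w i)) - n * ∫ a, F a ∂Q|} ≤ ENNReal.ofReal η := by
  have hlim : Filter.Tendsto (fun n : ℕ => Var[F; Q] / δ ^ 2 * (1 / (n : ℝ))) Filter.atTop (nhds 0) := by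
    have := (tendsto_one_div_atTop_nhds_zero_nat (𝕜 := ℝ)).const_mul (Var[F; Q] / δ ^ 2)
    simpa using this
  filter_upwards [hlim.eventually (gt_mem_nhds hη), Filter.eventually_ge_atTop 1] with n hn hn1
  have hn0 : (0 : ℝ) < n := by exact_mod_cast hn1
  set P := Measure.pi fun _ : Fin n => Q
  have hcomp : ∀ i : Fin n, MemLp (fun w : Fin n → Ω => F (w i)) 2 P := fun i =>
    hF.comp_measurePreserving (measurePreserving_eval (fun _ : Fin n => Q) i)
  have hsum : MemLp (fun w : Fin n → Ω => ∑ i, F (w i)) 2 P :=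
    memLp_finsetSum _ fun i _ => hcomp i
  have hvar : Var[fun w : Fin n → Ω => ∑ i, F (w i); P] = n * Var[F; Q] := by
    have := variance_sum_pi (μ := fun _ : Fin n => Q) (X := fun _ => F) (fun _ => hF)
    have h2 : (fun w : Fin n → Ω => ∑ i, F (w i)) = ∑ i : Fin n, fun w : Fin n → Ω => F (w i) := by
      ext w; simp
    rw [h2, this]; simp
  have hE : ∫ w, ∑ i, F (w i) ∂P = n * ∫ a, F a ∂Q := by
    rw [integral_finsetSum _ fun i _ => (hcomp i).integrable (by norm_num)]
    have : ∀ i : Fin n, ∫ w, F (w i) ∂P = ∫ a, F a ∂Q := fun i =>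
      integral_comp_eval (μ := fun _ : Fin n => Q) hF.aestronglyMeasurable
    simp [this]
  have := meas_ge_le_variance_div_sq hsum (c := δ * n) (by positivity)
  rw [hvar, hE] at this
  refine this.trans (ENNReal.ofReal_le_ofReal ?_)
  refine le_trans (le_of_eq ?_) hn.le
  field_simp

lemma one_shot {α β : Type*} [MeasurableSpace α] [MeasurableSpace β]
    (μ : Measure α) (κ : Measure β) [IsProbabilityMeasure μ] [IsProbabilityMeasure κ]
    (r : α × β → ℝ≥0∞) (hr : Measurable r) (hr1 : ∀ x, ∫⁻ y, r (x, y) ∂κ = 1)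
    (B : Set (α × β)) (hB : MeasurableSet B) (K : ℝ) (hK : 0 < K)
    (hBK : ∀ p ∈ B, r p ≤ ENNReal.ofReal K) (M : ℕ) :
    ∃ c : Fin M → β, μ {x | ∀ i, (x, c i) ∉ B} ≤
      ((μ.prod κ).withDensity r) Bᶜ + ENNReal.ofReal (Real.exp (-(M / K))) := by
  set S : Set (α × (Fin M → β)) := {p | ∀ i, (p.1, p.2 i) ∉ B} with hS
  have hSm : MeasurableSet S := by
    have : S = ⋂ i, (fun p : α × (Fin M → β) => (p.1, p.2 i)) ⁻¹' Bᶜ := by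
      ext p; simp [hS]
    rw [this]
    exact MeasurableSet.iInter fun i => (by fun_prop : Measurable
      (fun p : α × (Fin M → β) => (p.1, p.2 i))) hB.compl
  set P := Measure.pi fun _ : Fin M => κ with hP
  have hpt : ∀ x, P (Prod.mk x ⁻¹' S) ≤
      (∫⁻ y in Prod.mk x ⁻¹' Bᶜ, r (x, y) ∂κ) + ENNReal.ofReal (Real.exp (-(M / K))) := by
    intro x
    set Bx := Prod.mk x ⁻¹' B with hBx
    have hBxm : MeasurableSet Bx := measurable_prodMk_left hB
    have h1 : Prod.mk x ⁻¹' S = Set.univ.pi fun _ : Fin M => Bxᶜ := by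
      ext c; simp [hS, hBx]
    have h2 : Prod.mk x ⁻¹' Bᶜ = Bxᶜ := rfl
    rw [h1, h2, hP, Measure.pi_pi]
    simp only [Finset.prod_const, Finset.card_univ, Fintype.card_fin]
    have hsum : (∫⁻ y in Bx, r (x, y) ∂κ) + ∫⁻ y in Bxᶜ, r (x, y) ∂κ = 1 := by
      rw [lintegral_add_compl _ hBxm, hr1]
    have hle : ∫⁻ y in Bx, r (x, y) ∂κ ≤ ENNReal.ofReal K * κ Bx := by
      rw [← setLIntegral_const]
      exact setLIntegral_mono measurable_const fun y hy => hBK _ hy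
    generalize hp : ∫⁻ y in Bx, r (x, y) ∂κ = p at *
    generalize hpc : ∫⁻ y in Bxᶜ, r (x, y) ∂κ = pc at *
    have hptop : p ≠ ∞ := by
      rintro rfl; simp at hsum
    have hpctop : pc ≠ ∞ := by
      rintro rfl; simp at hsum
    have hqc : κ Bxᶜ = 1 - κ Bx := prob_compl_eq_one_sub hBxm
    have hqle : κ Bx ≤ 1 := prob_le_one
    have hqtop : κ Bx ≠ ∞ := measure_ne_top _ _
    rw [hqc]
    generalize κ Bx = q at *
    lift p to NNReal using hptop
    lift pc to NNReal using hpctop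
    lift q to NNReal using hqtop
    have e1 : (p : ℝ) + pc = 1 := by exact_mod_cast hsum
    have e2 : (p : ℝ) ≤ K * q := by
      have := ENNReal.toReal_mono (by finiteness) hle
      simpa [ENNReal.toReal_mul, hK.le] using this
    have e3 : (q : ℝ) ≤ 1 := by exact_mod_cast hqle
    have e4 : ((1 : ℝ≥0∞) - q) ^ M = ENNReal.ofReal ((1 - (q : ℝ)) ^ M) := by
      rw [ENNReal.ofReal_pow (by linarith), ENNReal.ofReal_sub _ (by positivity)]
      simp
    rw [e4, ← ENNReal.ofReal_coe_nnreal (p := pc), ← ENNReal.ofReal_add (by positivity) (by positivity)]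
    apply ENNReal.ofReal_le_ofReal
    have e5 : (1 - (q : ℝ)) ^ M ≤ Real.exp (p * (-(M / K))) := by
      have : 1 - (q : ℝ) ≤ Real.exp (-(p / K)) := by
        have h3 : (p : ℝ) / K ≤ q := by rw [div_le_iff₀ hK]; linarith
        calc 1 - (q : ℝ) ≤ Real.exp (-q) := by linarith [Real.add_one_le_exp (-(q : ℝ))]
          _ ≤ _ := Real.exp_le_exp.2 (by linarith)
      calc (1 - (q : ℝ)) ^ M ≤ (Real.exp (-(p / K))) ^ M := pow_le_pow_left₀ (by linarith) this M
        _ = _ := by rw [← Real.exp_nat_mul]; congr 1; ring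
    have e6 : Real.exp (p * (-(M / K))) ≤ (pc : ℝ) * 1 + p * Real.exp (-(M / K)) := by
      have := convexOn_exp.2 (Set.mem_univ (0 : ℝ)) (Set.mem_univ (-(M / K : ℝ)))
        (NNReal.coe_nonneg pc) (NNReal.coe_nonneg p) (by linarith)
      simpa using this
    have e7 : (p : ℝ) * Real.exp (-(M / K)) ≤ 1 * Real.exp (-(M / K)) :=
      mul_le_mul_of_nonneg_right (by linarith [NNReal.coe_nonneg pc]) (Real.exp_nonneg _)
    linarith
  have hmS : Measurable fun c => μ ((fun x => (x, c)) ⁻¹' S) := measurable_measure_prodMk_right hSm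
  obtain ⟨c, hc⟩ := exists_le_lintegral (μ := P) hmS.aemeasurable
  refine ⟨c, le_trans hc ?_⟩
  rw [← Measure.prod_apply_symm hSm, Measure.prod_apply hSm]
  refine (lintegral_mono hpt).trans ?_
  rw [lintegral_add_right _ measurable_const, lintegral_const, measure_univ, mul_one]
  gcongr
  rw [withDensity_apply _ hB.compl, ← lintegral_indicator hB.compl,
    lintegral_prod _ (hr.indicator hB.compl).aemeasurable]
  refine lintegral_mono fun x => ?_
  rw [← lintegral_indicator (measurable_prodMk_left hB.compl)]
  rfl

lemma isProb_of_fiber {α β : Type*} [MeasurableSpace α] [MeasurableSpace β]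
    (μ : Measure α) (κ : Measure β) [IsProbabilityMeasure μ] [IsProbabilityMeasure κ]
    (r : α × β → ℝ≥0∞) (hr : Measurable r) (hr1 : ∀ x, ∫⁻ y, r (x, y) ∂κ = 1) :
    IsProbabilityMeasure ((μ.prod κ).withDensity r) := by
  refine ⟨?_⟩
  rw [withDensity_apply _ MeasurableSet.univ, Measure.restrict_univ, lintegral_prod _ hr.aemeasurable]
  simp [hr1]

lemma coding {A B : Type*} [MeasurableSpace A] [MeasurableSpace B]
    (ν : Measure A) (κ : Measure B) [IsProbabilityMeasure ν] [IsProbabilityMeasure κ]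
    (info d : A × B → ℝ) (hi : Measurable info) (hd : Measurable d)
    (hr1 : ∀ x, ∫⁻ y, ENNReal.ofReal (Real.exp (info (x, y))) ∂κ = 1)
    (J : Measure (A × B))
    (hJ : J = (ν.prod κ).withDensity fun p => ENNReal.ofReal (Real.exp (info p)))
    (hi2 : MemLp info 2 J) (hd2 : MemLp d 2 J) (hI : 0 ≤ ∫ p, info p ∂J)
    (δ η : ℝ) (hδ : 0 < δ) (hη : 0 < η) :
    ∀ᶠ n : ℕ in Filter.atTop, ∃ (M : ℕ) (c : Fin M → Fin n → B),
      (M + 1 : ℝ) ≤ Real.exp (n * ((∫ p, info p ∂J) + δ)) ∧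
      (Measure.pi fun _ : Fin n => ν)
        {x | ∀ k, n * ((∫ p, d p ∂J) + δ) ≤ ∑ i, d (x i, c k i)} ≤ ENNReal.ofReal η := by
  set I := ∫ p, info p ∂J with hIdef
  set D := ∫ p, d p ∂J with hDdef
  set r : A × B → ℝ≥0∞ := fun p => ENNReal.ofReal (Real.exp (info p)) with hr
  have hrm : Measurable r := by fun_prop
  have hprob : IsProbabilityMeasure ((ν.prod κ).withDensity r) := isProb_of_fiber ν κ r hrm hr1
  have : IsProbabilityMeasure J := by rw [hJ]; exact hprob
  have hexp : Filter.Tendsto (fun n : ℕ => Real.exp (-(Real.exp (n * (δ / 2)) - 2)))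
      Filter.atTop (nhds 0) := by
    refine Real.tendsto_exp_neg_atTop_nhds_zero.comp ?_
    refine Filter.tendsto_atTop_add_const_right _ _ ?_
    refine Real.tendsto_exp_atTop.comp ?_
    exact tendsto_natCast_atTop_atTop.atTop_mul_const (by positivity)
  have hexp2 : Filter.Tendsto (fun n : ℕ => Real.exp (n * (I + δ))) Filter.atTop Filter.atTop := by
    refine Real.tendsto_exp_atTop.comp ?_
    exact tendsto_natCast_atTop_atTop.atTop_mul_const (by positivity)
  filter_upwards [lln J info hi2 (δ / 2) (η / 3) (by positivity) (by positivity),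
    lln J d hd2 δ (η / 3) (by positivity) (by positivity),
    hexp.eventually (gt_mem_nhds (show 0 < η / 3 by positivity)),
    hexp2.eventually_ge_atTop 1] with n h1 h2 h3 h4
  set E := Real.exp (n * (I + δ)) with hE
  set K := Real.exp (n * (I + δ / 2)) with hKdef
  have hK1 : 1 ≤ K := Real.one_le_exp (by positivity)
  have hK : 0 < K := Real.exp_pos _
  set M := ⌊E⌋₊ - 1 with hM
  have hfl : 1 ≤ ⌊E⌋₊ := Nat.one_le_floor_iff _ |>.2 h4
  have hM1 : (M : ℝ) + 1 = ⌊E⌋₊ := by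
    rw [hM, Nat.cast_sub hfl]; simp
  have hMK : Real.exp (n * (δ / 2)) - 2 ≤ M / K := by
    rw [le_div_iff₀ hK]
    have : Real.exp (n * (δ / 2)) * K = E := by
      rw [hKdef, hE, ← Real.exp_add]; congr 1; ring
    have := Nat.lt_floor_add_one E
    nlinarith
  set G : Set ((Fin n → A) × (Fin n → B)) := {p | ∑ i, info (p.1 i, p.2 i) < n * (I + δ / 2) ∧
    ∑ i, d (p.1 i, p.2 i) < n * (D + δ)} with hG
  have hm1 : Measurable fun p : (Fin n → A) × (Fin n → B) => ∑ i, info (p.1 i, p.2 i) :=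
    Finset.measurable_sum _ fun i _ => hi.comp (by fun_prop)
  have hm2 : Measurable fun p : (Fin n → A) × (Fin n → B) => ∑ i, d (p.1 i, p.2 i) :=
    Finset.measurable_sum _ fun i _ => hd.comp (by fun_prop)
  have hGm : MeasurableSet G :=
    (measurableSet_lt hm1 measurable_const).inter (measurableSet_lt hm2 measurable_const)
  obtain ⟨c, hc⟩ := one_shot (Measure.pi fun _ : Fin n => ν) (Measure.pi fun _ : Fin n => κ)
    (fun p => ∏ i, r (p.1 i, p.2 i))
    (Finset.measurable_prod _ fun i _ => hrm.comp (by fun_prop))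
    (fun x => by
      rw [lintegral_pi_prod' (fun _ : Fin n => κ) (fun i y => r (x i, y))
        (fun i => hrm.comp (by fun_prop))]
      simp [hr, hr1]) G hGm K hK
    (fun p hp => by
      simp only [hr]
      rw [← ENNReal.ofReal_prod_of_nonneg (fun i _ => Real.exp_nonneg _), ← Real.exp_sum]
      exact ENNReal.ofReal_le_ofReal (Real.exp_le_exp.2 hp.1.le)) M
  refine ⟨M, c, ?_, ?_⟩
  · rw [hM1]; exact Nat.floor_le (Real.exp_nonneg _)
  · have hJn := (joint_pi (fun _ : Fin n => ν) (fun _ : Fin n => κ) (fun _ => r) (fun _ => hrm))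
    rw [← hJn.measure_preimage hGm.compl.nullMeasurableSet] at hc
    rw [← hJ] at hc
    refine le_trans (measure_mono ?_) (hc.trans ?_)
    · intro x hx k hk
      exact absurd hk.2 (not_lt.2 (hx k))
    · have hsub : (fun w : Fin n → A × B => ((fun i => (w i).1), (fun i => (w i).2))) ⁻¹' Gᶜ ⊆
          {w | δ / 2 * n ≤ |(∑ i, info (w i)) - n * I|} ∪ {w | δ * n ≤ |(∑ i, d (w i)) - n * D|} := by
        intro w hw
        simp only [hG, Set.preimage_compl, Set.mem_compl_iff, Set.mem_preimage, Set.mem_ofPred_eq,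
          not_and_or, not_lt] at hw
        rcases hw with hw | hw
        · left
          change δ / 2 * n ≤ |(∑ i, info (w i)) - n * I|
          refine le_trans ?_ (le_abs_self _)
          linarith
        · right
          change δ * n ≤ |(∑ i, d (w i)) - n * D|
          refine le_trans ?_ (le_abs_self _)
          linarith
      have h5 := (measure_mono hsub).trans ((measure_union_le _ _).trans (add_le_add h1 h2))
      have h6 : ENNReal.ofReal (Real.exp (-(M / K))) ≤ ENNReal.ofReal (η / 3) :=
        ENNReal.ofReal_le_ofReal (le_trans (Real.exp_le_exp.2 (by linarith)) h3.le)
      refine (add_le_add h5 h6).trans ?_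
      rw [← ENNReal.ofReal_add (by positivity) (by positivity),
        ← ENNReal.ofReal_add (by positivity) (by positivity)]
      exact ENNReal.ofReal_le_ofReal (by linarith)

lemma gauss_sq_memLp (c : ℝ) (v : NNReal) :
    MemLp (fun x : ℝ => (x - c) ^ 2) 2 (gaussianReal c v) := by
  have h4 : MemLp (fun x : ℝ => x - c) (4 : ℕ) (gaussianReal c v) :=
    (memLp_id_gaussianReal' (μ := c) (v := v) (4 : ℕ) (by simp)).sub (memLp_const c)
  rw [memLp_two_iff_integrable_sq (by fun_prop)]
  have := h4.integrable_norm_pow (by norm_num)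
  refine this.congr (Filter.Eventually.of_forall fun x => ?_)
  simp only [Real.norm_eq_abs]
  rw [← pow_mul, Even.pow_abs (by decide)]

lemma gauss_sq_integral (c : ℝ) (v : NNReal) :
    ∫ x, (x - c) ^ 2 ∂(gaussianReal c v) = v := by
  have := variance_eq_integral (μ := gaussianReal c v) (X := fun x => x) (by fun_prop)
  rw [variance_fun_id_gaussianReal, integral_id_gaussianReal] at this
  exact this.symm

noncomputable def ginfo (m s D : ℝ) (p : ℝ × ℝ) : ℝ :=
  Real.log (s ^ 2 / D) / 2 - (p.1 - p.2) ^ 2 / (2 * D) + (p.1 - m) ^ 2 / (2 * s ^ 2)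

lemma ginfo_meas (m s D : ℝ) : Measurable (ginfo m s D) := by
  unfold ginfo; fun_prop

lemma exp_half_log (a : ℝ) (ha : 0 < a) : Real.exp (Real.log a / 2) = √a := by
  rw [← Real.log_sqrt ha.le, Real.exp_log (by positivity)]

lemma ginfo_id1 (m s D x y : ℝ) (hs : 0 < s) (hD : 0 < D) (hDs : D < s ^ 2) :
    gaussianPDFReal m (s ^ 2 - D).toNNReal y * Real.exp (ginfo m s D (x, y)) =
    gaussianPDFReal (m + (s ^ 2 - D) / s ^ 2 * (x - m)) (D * (s ^ 2 - D) / s ^ 2).toNNReal y := by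
  have ht : 0 < s ^ 2 - D := by linarith
  have hv : 0 < D * (s ^ 2 - D) / s ^ 2 := by positivity
  have hp := Real.pi_pos
  simp only [gaussianPDFReal, ginfo]
  rw [Real.coe_toNNReal _ ht.le, Real.coe_toNNReal _ hv.le]
  rw [sub_eq_add_neg (Real.log _ / 2)]
  have e1 : √(2 * Real.pi * (D * (s ^ 2 - D) / s ^ 2)) * √(s ^ 2 / D) = √(2 * Real.pi * (s ^ 2 - D)) := by
    rw [← Real.sqrt_mul (by positivity)]; congr 1; field_simp
  rw [add_assoc (Real.log _ / 2), Real.exp_add (Real.log _ / 2), exp_half_log _ (by positivity), ← e1]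
  have h1 : 0 < √(2 * Real.pi * (D * (s ^ 2 - D) / s ^ 2)) := by positivity
  have h2 : 0 < √(s ^ 2 / D) := by positivity
  rw [show ∀ a b c d : ℝ, 0 < b → (a * b)⁻¹ * c * (b * d) = a⁻¹ * (c * d) from by
    intro a b c d hb; field_simp]
  · rw [← Real.exp_add]
    congr 2
    have : s ^ 2 - D ≠ 0 := ht.ne'
    have hs2 : s ^ 2 ≠ 0 := by positivity
    field_simp
    ring
  · exact h2

lemma ginfo_id2 (m s D x y : ℝ) (hs : 0 < s) (hD : 0 < D) :
    gaussianPDFReal m (s ^ 2).toNNReal x * Real.exp (ginfo m s D (x, y)) =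
    gaussianPDFReal y D.toNNReal x := by
  have hp := Real.pi_pos
  simp only [gaussianPDFReal, ginfo]
  rw [Real.coe_toNNReal _ (by positivity), Real.coe_toNNReal _ hD.le]
  have e1 : √(2 * Real.pi * D) * √(s ^ 2 / D) = √(2 * Real.pi * s ^ 2) := by
    rw [← Real.sqrt_mul (by positivity)]; congr 1; field_simp
  rw [sub_eq_add_neg (Real.log _ / 2), add_assoc (Real.log _ / 2), Real.exp_add (Real.log _ / 2),
    exp_half_log _ (by positivity), ← e1]
  have h2 : 0 < √(s ^ 2 / D) := by positivity
  rw [show ∀ a b c d : ℝ, 0 < b → (a * b)⁻¹ * c * (b * d) = a⁻¹ * (c * d) from by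
    intro a b c d hb; field_simp]
  · rw [← Real.exp_add]
    congr 2
    field_simp
    ring
  · exact h2

lemma ginfo_fiber (m s D x : ℝ) (hs : 0 < s) (hD : 0 < D) (hDs : D < s ^ 2) :
    ∫⁻ y, ENNReal.ofReal (Real.exp (ginfo m s D (x, y))) ∂(gaussianReal m (s ^ 2 - D).toNNReal)
      = 1 := by
  have ht : 0 < s ^ 2 - D := by linarith
  have hv : 0 < D * (s ^ 2 - D) / s ^ 2 := by positivity
  have hm := ginfo_meas m s D
  rw [gaussianReal_of_var_ne_zero _ (by simpa using ht),
    lintegral_withDensity_eq_lintegral_mul _ (measurable_gaussianPDF _ _) (by fun_prop),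
    ← lintegral_gaussianPDF_eq_one (m + (s ^ 2 - D) / s ^ 2 * (x - m))
      (v := (D * (s ^ 2 - D) / s ^ 2).toNNReal) (by simpa using hv)]
  refine lintegral_congr fun y => ?_
  simp only [Pi.mul_apply, gaussianPDF]
  rw [← ENNReal.ofReal_mul (gaussianPDFReal_nonneg _ _ _), ginfo_id1 m s D x y hs hD hDs]

noncomputable def gJ (m s D : ℝ) : Measure (ℝ × ℝ) :=
  ((gaussianReal m (s ^ 2).toNNReal).prod (gaussianReal m (s ^ 2 - D).toNNReal)).withDensity
    fun p => ENNReal.ofReal (Real.exp (ginfo m s D p))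

lemma gJ_prob (m s D : ℝ) (hs : 0 < s) (hD : 0 < D) (hDs : D < s ^ 2) :
    IsProbabilityMeasure (gJ m s D) := by
  have hm := ginfo_meas m s D
  exact isProb_of_fiber _ _ _ (by fun_prop) fun x => ginfo_fiber m s D x hs hD hDs

lemma map_fst_withDensity {α β : Type*} [MeasurableSpace α] [MeasurableSpace β]
    (μ : Measure α) (κ : Measure β) [IsProbabilityMeasure μ] [IsProbabilityMeasure κ]
    (r : α × β → ℝ≥0∞) (hr : Measurable r) (hr1 : ∀ x, ∫⁻ y, r (x, y) ∂κ = 1) :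
    MeasurePreserving Prod.fst ((μ.prod κ).withDensity r) μ := by
  refine ⟨measurable_fst, ?_⟩
  ext s hs
  rw [Measure.map_apply measurable_fst hs, withDensity_apply _ (measurable_fst hs),
    ← lintegral_indicator (measurable_fst hs),
    lintegral_prod _ (hr.indicator (measurable_fst hs)).aemeasurable]
  have : ∀ x, ∫⁻ y, (Prod.fst ⁻¹' s).indicator r (x, y) ∂κ = s.indicator 1 x := by
    intro x
    by_cases hx : x ∈ s
    · simp [Set.indicator, hx, hr1]
    · simp [Set.indicator, hx]
  simp_rw [this]
  rw [lintegral_indicator_one hs]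

lemma gJ_sub (m s D : ℝ) (hs : 0 < s) (hD : 0 < D) :
    MeasurePreserving (fun p : ℝ × ℝ => p.1 - p.2) (gJ m s D) (gaussianReal 0 D.toNNReal) := by
  have hm := ginfo_meas m s D
  have hsub : Measurable (fun p : ℝ × ℝ => p.1 - p.2) := by fun_prop
  have hr : Measurable fun p => ENNReal.ofReal (Real.exp (ginfo m s D p)) := by fun_prop
  refine ⟨hsub, ?_⟩
  ext S hS
  rw [Measure.map_apply hsub hS, gJ, withDensity_apply _ (hsub hS),
    ← lintegral_indicator (hsub hS), lintegral_prod_symm _ (hr.indicator (hsub hS)).aemeasurable]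
  have : ∀ y, ∫⁻ x, ((fun p : ℝ × ℝ => p.1 - p.2) ⁻¹' S).indicator
      (fun p => ENNReal.ofReal (Real.exp (ginfo m s D p))) (x, y)
        ∂(gaussianReal m (s ^ 2).toNNReal) = gaussianReal 0 D.toNNReal S := by
    intro y
    have hSy : MeasurableSet ((fun x : ℝ => x - y) ⁻¹' S) := (by fun_prop : Measurable fun x : ℝ => x - y) hS
    rw [gaussianReal_of_var_ne_zero _ (by simpa using hs.ne')]
    refine Eq.trans (lintegral_withDensity_eq_lintegral_mul _ (measurable_gaussianPDF _ _)
        ((hr.indicator (hsub hS)).comp (measurable_prodMk_right (y := y)))) ?_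
    have h1 : gaussianReal 0 D.toNNReal = (gaussianReal y D.toNNReal).map (fun x => x - y) := by
      rw [gaussianReal_map_sub_const, sub_self]
    rw [h1, Measure.map_apply (by fun_prop) hS, gaussianReal_apply _ (by simpa using hD),
      ← lintegral_indicator hSy]
    refine lintegral_congr fun x => ?_
    by_cases hx : x - y ∈ S
    · simp only [Pi.mul_apply, Set.indicator, Set.mem_preimage, hx, if_true, gaussianPDF]
      rw [← ENNReal.ofReal_mul (gaussianPDFReal_nonneg _ _ _), ginfo_id2 m s D x y hs hD]
    · simp [Set.indicator, hx]
  simp_rw [this]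
  simp

lemma ginfo_memLp (m s D : ℝ) (hs : 0 < s) (hD : 0 < D) (hDs : D < s ^ 2) :
    MemLp (ginfo m s D) 2 (gJ m s D) ∧ ∫ p, ginfo m s D p ∂(gJ m s D) = Real.log (s ^ 2 / D) / 2 ∧
    MemLp (fun p : ℝ × ℝ => (p.1 - p.2) ^ 2) 2 (gJ m s D) ∧
    ∫ p, (p.1 - p.2) ^ 2 ∂(gJ m s D) = D := by
  have hprob := gJ_prob m s D hs hD hDs
  have hm := ginfo_meas m s D
  have hsub := gJ_sub m s D hs hD
  have hfst : MeasurePreserving Prod.fst (gJ m s D) (gaussianReal m (s ^ 2).toNNReal) :=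
    map_fst_withDensity _ _ _ (by fun_prop) fun x => ginfo_fiber m s D x hs hD hDs
  have a1 : MemLp (fun p : ℝ × ℝ => (p.1 - p.2) ^ 2) 2 (gJ m s D) := by
    have := (gauss_sq_memLp 0 D.toNNReal).comp_measurePreserving hsub
    simpa [Function.comp_def] using this
  have a2 : MemLp (fun p : ℝ × ℝ => (p.1 - m) ^ 2) 2 (gJ m s D) :=
    (gauss_sq_memLp m (s ^ 2).toNNReal).comp_measurePreserving hfst
  have b1 : ∫ p, (p.1 - p.2) ^ 2 ∂(gJ m s D) = D := by
    have h := gauss_sq_integral 0 D.toNNReal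
    rw [← hsub.map_eq, integral_map hsub.measurable.aemeasurable (by fun_prop)] at h
    simpa [hD.le] using h
  have b2 : ∫ p, (p.1 - m) ^ 2 ∂(gJ m s D) = s ^ 2 := by
    have h := gauss_sq_integral m (s ^ 2).toNNReal
    rw [← hfst.map_eq, integral_map hfst.measurable.aemeasurable (by fun_prop)] at h
    simpa [sq_nonneg] using h
  have i1 := (a1.integrable (by norm_num)).div_const (2 * D)
  have i2 := (a2.integrable (by norm_num)).div_const (2 * s ^ 2)
  refine ⟨?_, ?_, a1, b1⟩
  · have := ((memLp_const (μ := gJ m s D) (p := 2) (Real.log (s ^ 2 / D) / 2)).sub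
      (a1.const_mul (1 / (2 * D)))).add (a2.const_mul (1 / (2 * s ^ 2)))
    refine (memLp_congr_ae (Filter.Eventually.of_forall fun p => ?_)).1 this
    simp only [ginfo, Pi.add_apply, Pi.sub_apply]
    ring
  · simp only [ginfo]
    have i3 : Integrable (fun p : ℝ × ℝ => Real.log (s ^ 2 / D) / 2 - (p.1 - p.2) ^ 2 / (2 * D))
        (gJ m s D) := (integrable_const _).sub i1
    rw [integral_add i3 i2, integral_sub (integrable_const _) i1,
      integral_div (2 * D), integral_div (2 * s ^ 2), b1, b2]
    simp
    field_simp
    ring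

lemma sel {α : Type*} [MeasurableSpace α] (M : ℕ) (T : Fin M → Set α)
    (hT : ∀ k, MeasurableSet (T k)) :
    ∃ f : α → Fin (M + 1), Measurable f ∧ ∀ x, (∃ k : Fin M, f x = k.castSucc ∧ x ∈ T k) ∨
      (f x = Fin.last M ∧ ∀ k, x ∉ T k) := by
  classical
  set p : α → ℕ → Prop := fun x N => (∃ h : N < M, x ∈ T ⟨N, h⟩) ∨ N = M with hp
  have hex : ∀ x, ∃ N, p x N := fun x => ⟨M, Or.inr rfl⟩
  have hmeas : Measurable fun x => Nat.find (hex x) := by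
    refine measurable_find hex fun k => ?_
    by_cases hk : k < M
    · have : {x | p x k} = T ⟨k, hk⟩ := by
        ext x
        simp [hp, hk, hk.ne]
      rw [this]; exact hT _
    · by_cases hk2 : k = M
      · have : {x | p x k} = Set.univ := by ext x; simp [hp, hk2]
        rw [this]; exact MeasurableSet.univ
      · have : {x | p x k} = ∅ := by ext x; simp [hp, hk2, hk]
        rw [this]; exact MeasurableSet.empty
  have hle : ∀ x, Nat.find (hex x) < M + 1 := fun x =>
    Nat.lt_succ_of_le (Nat.find_min' (hex x) (Or.inr rfl))
  refine ⟨fun x => Fin.ofNat (M + 1) (Nat.find (hex x)),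
    (measurable_of_countable (fun N : ℕ => Fin.ofNat (M + 1) N)).comp hmeas, fun x => ?_⟩
  have hval : Fin.ofNat (M + 1) (Nat.find (hex x)) = ⟨Nat.find (hex x), hle x⟩ := by
    ext; simp [Fin.ofNat, Nat.mod_eq_of_lt (hle x)]
  beta_reduce
  rw [hval]
  by_cases hN : Nat.find (hex x) < M
  · left
    refine ⟨⟨_, hN⟩, rfl, ?_⟩
    rcases Nat.find_spec (hex x) with ⟨h, hx⟩ | h
    · exact hx
    · omega
  · right
    refine ⟨?_, fun k hk => ?_⟩
    · ext; simp; have := hle x; omega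
    · exact hN (lt_of_le_of_lt (Nat.find_min' (hex x) (Or.inl ⟨k.2, hk⟩)) k.2)

lemma vec_coding (l : ℕ) (m σ D : Fin l → ℝ) (hσ : ∀ j, 0 < σ j) (hD : ∀ j, 0 < D j)
    (hDs : ∀ j, D j < σ j ^ 2) (δ η : ℝ) (hδ : 0 < δ) (hη : 0 < η) :
    ∀ᶠ n : ℕ in Filter.atTop, ∃ (M : ℕ) (c : Fin M → Fin n → Fin l → ℝ),
      (M + 1 : ℝ) ≤ Real.exp (n * ((∑ j, Real.log (σ j ^ 2 / D j) / 2) + δ)) ∧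
      (Measure.pi fun _ : Fin n =>
        Measure.pi fun j => gaussianReal (m j) (Real.toNNReal ((σ j) ^ 2)))
        {x | ∀ k, n * ((∑ j, D j) + δ) ≤ ∑ i, ∑ j, (x i j - c k i j) ^ 2} ≤ ENNReal.ofReal η := by
  set ν : Fin l → Measure ℝ := fun j => gaussianReal (m j) (Real.toNNReal ((σ j) ^ 2)) with hν
  set κ : Fin l → Measure ℝ := fun j => gaussianReal (m j) (Real.toNNReal ((σ j) ^ 2 - D j)) with hκ
  set info : (Fin l → ℝ) × (Fin l → ℝ) → ℝ := fun p =>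
    ∑ j, ginfo (m j) (σ j) (D j) (p.1 j, p.2 j) with hinfo
  set d : (Fin l → ℝ) × (Fin l → ℝ) → ℝ := fun p => ∑ j, (p.1 j - p.2 j) ^ 2 with hd
  set r : Fin l → ℝ × ℝ → ℝ≥0∞ := fun j p =>
    ENNReal.ofReal (Real.exp (ginfo (m j) (σ j) (D j) p)) with hr
  have hrm : ∀ j, Measurable (r j) := fun j => by
    have := ginfo_meas (m j) (σ j) (D j)
    simp only [hr]; fun_prop
  have hgm : ∀ j, Measurable fun p : (Fin l → ℝ) × (Fin l → ℝ) =>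
      ginfo (m j) (σ j) (D j) (p.1 j, p.2 j) := fun j =>
    (ginfo_meas (m j) (σ j) (D j)).comp (by fun_prop)
  have him : Measurable info := Finset.measurable_sum _ fun j _ => hgm j
  have hdm : Measurable d := by simp only [hd]; fun_prop
  have hprod : ∀ p : (Fin l → ℝ) × (Fin l → ℝ),
      ENNReal.ofReal (Real.exp (info p)) = ∏ j, r j (p.1 j, p.2 j) := by
    intro p
    simp only [hr, hinfo]
    rw [Real.exp_sum, ENNReal.ofReal_prod_of_nonneg (fun i _ => Real.exp_nonneg _)]
  set J := ((Measure.pi ν).prod (Measure.pi κ)).withDensity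
    fun p => ENNReal.ofReal (Real.exp (info p)) with hJ
  have hgp : ∀ j, IsProbabilityMeasure (((ν j).prod (κ j)).withDensity (r j)) := fun j =>
    gJ_prob (m j) (σ j) (D j) (hσ j) (hD j) (hDs j)
  have hjoint := joint_pi ν κ r hrm
  have hproj : ∀ j, MeasurePreserving (fun p : (Fin l → ℝ) × (Fin l → ℝ) => (p.1 j, p.2 j)) J
      (gJ (m j) (σ j) (D j)) := by
    intro j
    refine ⟨by fun_prop, ?_⟩
    rw [hJ]
    simp_rw [hprod]
    rw [← hjoint.map_eq, Measure.map_map (by fun_prop) hjoint.measurable]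
    exact (measurePreserving_eval (fun i => ((ν i).prod (κ i)).withDensity (r i)) j).map_eq
  have hall := fun j => ginfo_memLp (m j) (σ j) (D j) (hσ j) (hD j) (hDs j)
  have h1 : ∀ j, MemLp (fun p : (Fin l → ℝ) × (Fin l → ℝ) =>
      ginfo (m j) (σ j) (D j) (p.1 j, p.2 j)) 2 J := fun j =>
    (hall j).1.comp_measurePreserving (hproj j)
  have h2 : ∀ j, MemLp (fun p : (Fin l → ℝ) × (Fin l → ℝ) => (p.1 j - p.2 j) ^ 2) 2 J := fun j =>
    (hall j).2.2.1.comp_measurePreserving (hproj j)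
  have hfib : ∀ x, ∫⁻ y, ENNReal.ofReal (Real.exp (info (x, y))) ∂(Measure.pi κ) = 1 := by
    intro x
    simp_rw [hprod]
    rw [lintegral_pi_prod' κ (fun j y => r j (x j, y)) (fun j => (hrm j).comp (by fun_prop))]
    exact Finset.prod_eq_one fun j _ => ginfo_fiber (m j) (σ j) (D j) (x j) (hσ j) (hD j) (hDs j)
  have hJp : IsProbabilityMeasure J := isProb_of_fiber _ _ _ (by fun_prop) hfib
  have e1 : ∫ p, info p ∂J = ∑ j, Real.log (σ j ^ 2 / D j) / 2 := by
    simp only [hinfo]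
    rw [integral_finsetSum _ fun j _ => (h1 j).integrable (by norm_num)]
    refine Finset.sum_congr rfl fun j _ => ?_
    rw [← (hall j).2.1, ← (hproj j).map_eq, integral_map (hproj j).measurable.aemeasurable
      (ginfo_meas (m j) (σ j) (D j)).aestronglyMeasurable]
  have e2 : ∫ p, d p ∂J = ∑ j, D j := by
    simp only [hd]
    rw [integral_finsetSum _ fun j _ => (h2 j).integrable (by norm_num)]
    refine Finset.sum_congr rfl fun j _ => ?_
    conv_rhs => rw [← (hall j).2.2.2, ← (hproj j).map_eq, integral_map (hproj j).measurable.aemeasurable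
      (by fun_prop)]
  have hI : 0 ≤ ∫ p, info p ∂J := by
    rw [e1]
    refine Finset.sum_nonneg fun j _ => ?_
    have : 1 ≤ σ j ^ 2 / D j := by rw [one_le_div (hD j)]; exact (hDs j).le
    have := Real.log_nonneg this
    positivity
  have := coding (Measure.pi ν) (Measure.pi κ) info d him hdm hfib J hJ
    (memLp_finsetSum _ fun j _ => h1 j) (memLp_finsetSum _ fun j _ => h2 j) hI δ η hδ hη
  rw [e1, e2] at this
  exact this

/-- Achievability part of Theorem 2 of the paper for a Gaussian memoryless vector
source with independent components: for every `R ≥ 0` and `ε > 0` there is a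
blocklength-`n` code with at most `2 ^ (n (R + ε))` codewords whose expected
per-vector squared-error distortion is at most the optimal value of the
bit-allocation problem plus `ε`. -/
theorem gaussian_vector_rate_distortion_achievability
    (l : ℕ) (hl : 1 ≤ l) (m σ : Fin l → ℝ) (hσ : ∀ j, 0 < σ j)
    (ν : Measure (Fin l → ℝ))
    (hν : ν = Measure.pi fun j => gaussianReal (m j) (Real.toNNReal ((σ j) ^ 2)))
    (R : ℝ) (hR : 0 ≤ R) (ε : ℝ) (hε : 0 < ε) :
    ∃ (n M : ℕ) (f : (Fin n → Fin l → ℝ) → Fin M) (g : Fin M → Fin n → Fin l → ℝ),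
      1 ≤ n ∧ Measurable f ∧ (M : ℝ) ≤ 2 ^ ((n : ℝ) * (R + ε)) ∧
      vecExpectedDistortion l n M ν f g ≤ bitAllocationValue l σ R + ε := by
  have hl0 : (0 : ℝ) < l := by exact_mod_cast hl
  obtain ⟨_, ⟨ρ, hρ0, hρR, rfl⟩, hval⟩ := exists_lt_of_csInf_lt
    (s := {d : ℝ | ∃ ρ : Fin l → ℝ, (∀ j, 0 ≤ ρ j) ∧ (∑ j, ρ j) ≤ R ∧
      d = ∑ j, (σ j) ^ 2 * 2 ^ (-(2 * ρ j))})
    ⟨_, 0, fun _ => le_rfl, by simpa using hR, rfl⟩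
    (show sInf _ < bitAllocationValue l σ R + ε / 4 by unfold bitAllocationValue; linarith)
  set ρ' : Fin l → ℝ := fun j => ρ j + ε / (2 * l) with hρ'
  have hρ'0 : ∀ j, 0 < ρ' j := fun j => by have := hρ0 j; simp only [hρ']; positivity
  set D : Fin l → ℝ := fun j => (σ j) ^ 2 * 2 ^ (-(2 * ρ' j)) with hDdef
  have hD : ∀ j, 0 < D j := fun j => by have := hσ j; simp only [hDdef]; positivity
  have hDs : ∀ j, D j < σ j ^ 2 := fun j => by
    have h1 : (2 : ℝ) ^ (-(2 * ρ' j)) < 1 :=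
      Real.rpow_lt_one_of_one_lt_of_neg (by norm_num) (by linarith [hρ'0 j])
    have := pow_pos (hσ j) 2
    simp only [hDdef]; nlinarith
  have hDsum : ∑ j, D j ≤ bitAllocationValue l σ R + ε / 4 := by
    refine le_trans (Finset.sum_le_sum fun j _ => ?_) hval.le
    refine mul_le_mul_of_nonneg_left ?_ (sq_nonneg _)
    refine Real.rpow_le_rpow_of_exponent_le (by norm_num) ?_
    have : 0 < ε / (2 * l) := by positivity
    simp only [hρ']; linarith
  have hlog : ∑ j, Real.log (σ j ^ 2 / D j) / 2 ≤ (R + ε / 2) * Real.log 2 := by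
    have h1 : ∀ j, Real.log (σ j ^ 2 / D j) / 2 = ρ' j * Real.log 2 := by
      intro j
      have h2 := (hσ j).ne'
      have : σ j ^ 2 / D j = 2 ^ (2 * ρ' j) := by
        simp only [hDdef]
        rw [Real.rpow_neg (by norm_num)]
        field_simp
      rw [this, Real.log_rpow (by norm_num)]; ring
    simp_rw [h1]
    rw [← Finset.sum_mul]
    refine mul_le_mul_of_nonneg_right ?_ (Real.log_nonneg (by norm_num))
    simp only [hρ', Finset.sum_add_distrib, Finset.sum_const, Finset.card_univ, Fintype.card_fin,
      nsmul_eq_mul]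
    have : (l : ℝ) * (ε / (2 * l)) = ε / 2 := by field_simp
    linarith
  set G : (Fin l → ℝ) → ℝ := fun x => ∑ j, (x j - m j) ^ 2 with hG
  have hνp : IsProbabilityMeasure ν := by rw [hν]; infer_instance
  have hGL : MemLp G 2 ν := by
    refine memLp_finsetSum _ fun j _ => ?_
    rw [hν]
    exact (gauss_sq_memLp (m j) _).comp_measurePreserving (measurePreserving_eval
      (fun j => gaussianReal (m j) (Real.toNNReal ((σ j) ^ 2))) j)
  have hG2 : Integrable (fun x => G x ^ 2) ν := hGL.integrable_sq
  set C := ∫ x, G x ^ 2 ∂ν with hC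
  have hC0 : 0 ≤ C := integral_nonneg fun x => sq_nonneg _
  set θ := ε / (2 * (C + 1)) with hθ
  have hθ0 : 0 < θ := by positivity
  obtain ⟨n, ⟨M, c, hM, hF⟩, hn⟩ := ((vec_coding l m σ D hσ hD hDs (ε / 4) (θ * ε / 2)
    (by positivity) (by positivity)).and (Filter.eventually_ge_atTop 1)).exists
  have hn0 : (0 : ℝ) < n := by exact_mod_cast hn
  rw [← hν] at hF
  set P := Measure.pi fun _ : Fin n => ν with hP
  set T : Fin M → Set (Fin n → Fin l → ℝ) := fun k =>
    {x | ∑ i, ∑ j, (x i j - c k i j) ^ 2 < n * ((∑ j, D j) + ε / 4)} with hT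
  have hTm : ∀ k, MeasurableSet (T k) := fun k =>
    measurableSet_lt (by fun_prop) measurable_const
  obtain ⟨f, hfm, hf⟩ := sel M T hTm
  refine ⟨n, M + 1, f, Fin.snoc (α := fun _ => Fin n → Fin l → ℝ) c (fun _ => m), hn, hfm, ?_, ?_⟩
  · push_cast
    refine hM.trans ?_
    rw [Real.rpow_def_of_pos (by norm_num)]
    refine Real.exp_le_exp.2 ?_
    have h2 := Real.log_two_gt_d9
    have h3 : (∑ j, Real.log (σ j ^ 2 / D j) / 2) + ε / 4 ≤ Real.log 2 * (R + ε) := by nlinarith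
    calc _ ≤ n * (Real.log 2 * (R + ε)) := mul_le_mul_of_nonneg_left h3 hn0.le
      _ = _ := by ring
  · set F : Set (Fin n → Fin l → ℝ) :=
      {x | ∀ k, n * ((∑ j, D j) + ε / 4) ≤ ∑ i, ∑ j, (x i j - c k i j) ^ 2} with hFdef
    have hFm : MeasurableSet F := by
      have : F = ⋂ k, (T k)ᶜ := by ext x; simp [hFdef, hT]
      rw [this]; exact MeasurableSet.iInter fun k => (hTm k).compl
    have hi1 : ∀ i : Fin n, Integrable (fun x : Fin n → Fin l → ℝ => G (x i) ^ 2) P := fun i =>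
      integrable_comp_eval (μ := fun _ : Fin n => ν) hG2
    have hi2 : Integrable (fun x : Fin n → Fin l → ℝ => θ / 2 * ((1 / (n : ℝ)) * ∑ i, G (x i) ^ 2)) P :=
      ((integrable_finsetSum _ fun i _ => hi1 i).const_mul _).const_mul _
    have hi3 : Integrable (F.indicator fun _ => 1 / (2 * θ)) P :=
      (integrable_const _).indicator hFm
    have hi0 : Integrable (fun _ : Fin n → Fin l → ℝ => (∑ j, D j) + ε / 4) P := integrable_const _
    have hD0 : 0 ≤ ∑ j, D j := Finset.sum_nonneg fun j _ => (hD j).le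
    unfold vecExpectedDistortion
    refine (integral_mono_of_nonneg (g := fun x => (((∑ j, D j) + ε / 4) +
      θ / 2 * ((1 / (n : ℝ)) * ∑ i, G (x i) ^ 2)) + F.indicator (fun _ => 1 / (2 * θ)) x)
      (Filter.Eventually.of_forall fun x => ?_) ((hi0.add hi2).add hi3)
      (Filter.Eventually.of_forall fun x => ?_)).trans ?_
    · simp only [Pi.zero_apply]
      exact mul_nonneg (by positivity) (Finset.sum_nonneg fun i _ => Finset.sum_nonneg fun j _ => sq_nonneg _)
    · have hnn : 0 ≤ θ / 2 * ((1 / (n : ℝ)) * ∑ i, G (x i) ^ 2) := by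
        have : 0 ≤ ∑ i, G (x i) ^ 2 := Finset.sum_nonneg fun i _ => sq_nonneg _
        positivity
      have hin : 0 ≤ F.indicator (fun _ => 1 / (2 * θ)) x :=
        Set.indicator_nonneg (fun _ _ => by positivity) x
      rcases hf x with ⟨k, hk, hx⟩ | ⟨hk, hx⟩
      · simp only [hk, Fin.snoc_castSucc]
        have h5 : (1 / (n : ℝ)) * ∑ i, ∑ j, (x i j - c k i j) ^ 2 ≤ (∑ j, D j) + ε / 4 := by
          rw [one_div, inv_mul_le_iff₀ hn0]
          exact le_of_lt hx
        linarith
      · simp only [hk, Fin.snoc_last]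
        have hxF : x ∈ F := fun k => not_lt.1 (hx k)
        rw [Set.indicator_of_mem hxF]
        have h6 : ∀ i, G (x i) ≤ θ / 2 * G (x i) ^ 2 + 1 / (2 * θ) := by
          intro i
          have : θ / 2 * G (x i) ^ 2 + 1 / (2 * θ) - G (x i) = (θ * G (x i) - 1) ^ 2 / (2 * θ) := by
            field_simp; ring
          have h7 : 0 ≤ (θ * G (x i) - 1) ^ 2 / (2 * θ) := by positivity
          linarith
        have h8 : (1 / (n : ℝ)) * ∑ i, G (x i) ≤
            θ / 2 * ((1 / (n : ℝ)) * ∑ i, G (x i) ^ 2) + 1 / (2 * θ) := by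
          calc (1 / (n : ℝ)) * ∑ i, G (x i)
              ≤ (1 / (n : ℝ)) * ∑ i, (θ / 2 * G (x i) ^ 2 + 1 / (2 * θ)) :=
                mul_le_mul_of_nonneg_left (Finset.sum_le_sum fun i _ => h6 i) (by positivity)
            _ = _ := by
              rw [Finset.sum_add_distrib, ← Finset.mul_sum]
              simp only [Finset.sum_const, Finset.card_univ, Fintype.card_fin, nsmul_eq_mul]
              field_simp
        simp only [hG] at h8 ⊢
        linarith
    · have hi4 : Integrable (fun x : Fin n → Fin l → ℝ => ((∑ j, D j) + ε / 4) +
          θ / 2 * ((1 / (n : ℝ)) * ∑ i, G (x i) ^ 2)) P := hi0.add hi2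
      rw [integral_add hi4 hi3, integral_add hi0 hi2, integral_indicator_const _ hFm,
        integral_const_mul, integral_const_mul, integral_finsetSum _ fun i _ => hi1 i]
      have h9 : ∀ i : Fin n, ∫ x, G (x i) ^ 2 ∂P = C := fun i =>
        integral_comp_eval (μ := fun _ : Fin n => ν) (f := fun y => G y ^ 2) hG2.aestronglyMeasurable
      have h10 : P.real F ≤ θ * ε / 2 := by
        rw [measureReal_def]
        exact ENNReal.toReal_le_of_le_ofReal (by positivity) hF
      have h11 : P.real F * (1 / (2 * θ)) ≤ ε / 4 := by
        calc _ ≤ (θ * ε / 2) * (1 / (2 * θ)) := mul_le_mul_of_nonneg_right h10 (by positivity)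
          _ = _ := by field_simp; norm_num
      have h12 : θ / 2 * C ≤ ε / 4 := by
        rw [hθ]
        have : ε / (2 * (C + 1)) / 2 * C = ε / 4 * (C / (C + 1)) := by field_simp; ring
        rw [this]
        have : C / (C + 1) ≤ 1 := by rw [div_le_one (by positivity)]; linarith
        nlinarith
      simp only [h9, Finset.sum_const, Finset.card_univ, Fintype.card_fin, nsmul_eq_mul, smul_eq_mul,
        integral_const, probReal_univ, one_mul]
      have h13 : 1 / (n : ℝ) * (n * C) = C := by field_simp
      rw [h13]
      linarith
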